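/- Let N ≥ 2 and let F_N denote the free group of rank N. Let (g_n)_{n∈ℕ} be a sequence of automorphisms of F_N representing pairwise distinct outer automorphisms, i.e., for all m ≠ n the automorphism g_n ∘ g_m⁻¹ is not an inner automorphism of F_N. Then there exists an element w ∈ F_N such that the set of conjugacy classes { [g_n(w)] : n ∈ ℕ } in F_N is infinite. -/

import Mathlib

/-- An automorphism of a group is inner if it is conjugation by a fixed element. -/
def IsInnerAut {G : Type*} [Group G] (φ : MulAut G) : Prop :=
  ∃ a : G, ∀ x : G, φ x = a * x * a⁻¹

namespace FreeGroup

variable {α : Type*}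

/-- A reduced word that is not cyclically reduced begins and ends with mutually inverse letters. -/
theorem IsReduced.exists_eq_cons_append {L : List (α × Bool)} (h : IsReduced L)
    (hc : ¬ IsCyclicallyReduced L) : ∃ a L', L = a :: (L' ++ [(a.1, !a.2)]) := by
  induction L using List.bidirectionalRec with
  | nil => simp at hc
  | singleton => simp at hc
  | cons_append a l b ih =>
    rw [← List.cons_append] at h hc
    rw [isCyclicallyReduced_cons_append_iff] at hc
    have hba : b = (a.1, !a.2) := by
      obtain ⟨a, s⟩ := a
      obtain ⟨b, t⟩ := b
      cases s <;> cases t <;> simp_all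
    exact ⟨a, l, by rw [hba]⟩

variable [DecidableEq α]

theorem norm_pow_le (x : FreeGroup α) (n : ℕ) : norm (x ^ n) ≤ n * norm x := by
  induction n with
  | zero => simp
  | succ n ih =>
    rw [pow_succ, add_mul, one_mul]
    exact (norm_mul_le _ _).trans (by gcongr)

theorem norm_conj_le (x y : FreeGroup α) : norm (x * y * x⁻¹) ≤ 2 * norm x + norm y := by
  have h₁ := norm_mul_le (x * y) x⁻¹
  have h₂ := norm_mul_le x y
  rw [norm_inv_eq] at h₁
  omega

theorem norm_pow_of_isCyclicallyReduced {x : FreeGroup α} (hx : IsCyclicallyReduced x.toWord)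
    (n : ℕ) : norm (x ^ n) = n * norm x := by
  rw [norm, toWord_pow, (hx.flatten_replicate n).isReduced.reduce_eq]
  simp [norm]

/-- An element with cyclically reduced word is shortest in its conjugacy class. -/
theorem norm_le_of_isConj {x y : FreeGroup α} (hx : IsCyclicallyReduced x.toWord)
    (h : IsConj y x) : norm x ≤ norm y := by
  obtain ⟨c, rfl⟩ := isConj_iff.1 h
  by_contra! hlt
  have h₁ := norm_conj_le c (y ^ (2 * norm c + 1))
  rw [← conj_pow, norm_pow_of_isCyclicallyReduced hx] at h₁
  have h₂ := norm_pow_le y (2 * norm c + 1)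
  nlinarith

/-- If the reduced words of `x` and `y` are `a ⋯ a⁻¹` and `b ⋯ b⁻¹` with `a ≠ b`, then the word
of `x * y` is their concatenation, and it is cyclically reduced. -/
theorem toWord_mul_of_ne {x y : FreeGroup α} {a b : α × Bool} {L M : List (α × Bool)}
    (hx : x.toWord = a :: (L ++ [(a.1, !a.2)])) (hy : y.toWord = b :: (M ++ [(b.1, !b.2)]))
    (hab : a ≠ b) :
    (x * y).toWord = x.toWord ++ y.toWord ∧ IsCyclicallyReduced (x.toWord ++ y.toWord) := by
  have hne : a.1 = b.1 → (!a.2) = b.2 := by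
    obtain ⟨a, s⟩ := a
    obtain ⟨b, t⟩ := b
    cases s <;> cases t <;> simp_all
  have hred : IsReduced (x.toWord ++ y.toWord) := by
    refine List.isChain_append.2 ⟨isReduced_toWord, isReduced_toWord, ?_⟩
    rw [hx, hy, ← List.cons_append, List.getLast?_concat]
    simpa using hne
  refine ⟨by rw [toWord_mul, hred.reduce_eq], hred, ?_⟩
  have hlast : (x.toWord ++ y.toWord).getLast? = some (b.1, !b.2) := by
    rw [hy, ← List.cons_append, ← List.append_assoc, List.getLast?_concat]
  rw [hlast, hx]
  simp only [Option.mem_def, Option.some.injEq, List.cons_append, List.head?_cons]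
  rintro _ rfl _ rfl h
  simp [← hne h.symm]

/-- If the elements `f i` and `f i * f j` are conjugate to elements of norm at most `C`, then the
`f i` are simultaneously conjugate to elements of norm at most `C + 2`. -/
theorem exists_forall_norm_conj_le {ι : Type*} [Finite ι] (f : ι → FreeGroup α) (C : ℕ)
    (h₁ : ∀ i, ∃ c, IsConj c (f i) ∧ norm c ≤ C)
    (h₂ : ∀ i j, ∃ c, IsConj c (f i * f j) ∧ norm c ≤ C) :
    ∃ x, ∀ i, norm (x⁻¹ * f i * x) ≤ C + 2 := by
  classical
  have hex : ∃ D, ∃ x, ∀ i, norm (x⁻¹ * f i * x) ≤ D := by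
    obtain ⟨D, hD⟩ := (Set.finite_range fun i => norm (f i)).bddAbove
    exact ⟨D, 1, fun i => by simpa using hD ⟨i, rfl⟩⟩
  obtain ⟨x, hx⟩ := Nat.find_spec hex
  have hmin : ∀ m < Nat.find hex, ¬ ∃ x, ∀ i, norm (x⁻¹ * f i * x) ≤ m := fun m => Nat.find_min hex
  generalize Nat.find hex = D at hx hmin
  by_cases hDC : D ≤ C + 2
  · exact ⟨x, fun i => (hx i).trans hDC⟩
  refine absurd ?_ (hmin (D - 1) (by omega))
  have hconj (y : FreeGroup α) : IsConj y (x⁻¹ * y * x) := isConj_iff.2 ⟨x⁻¹, by simp⟩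
  have hword (i) (hi : D - 2 ≤ norm (x⁻¹ * f i * x)) :
      ∃ a L, (x⁻¹ * f i * x).toWord = a :: (L ++ [(a.1, !a.2)]) := by
    refine isReduced_toWord.exists_eq_cons_append fun hc => ?_
    obtain ⟨c, hc', hcC⟩ := h₁ i
    have := norm_le_of_isConj hc (hc'.trans (hconj _))
    omega
  by_cases hbig : ∃ i, D - 2 ≤ norm (x⁻¹ * f i * x)
  swap
  · push Not at hbig
    exact ⟨x, fun i => by have := hbig i; omega⟩
  obtain ⟨i, hi⟩ := hbig
  obtain ⟨a, L, hL⟩ := hword i hi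
  refine ⟨x * mk [a], fun j => ?_⟩
  have hj_eq : (x * mk [a])⁻¹ * f j * (x * mk [a])
      = (mk [a])⁻¹ * (x⁻¹ * f j * x) * ((mk [a])⁻¹)⁻¹ := by group
  rw [hj_eq]
  by_cases hj : D - 2 ≤ norm (x⁻¹ * f j * x)
  · obtain ⟨b, M, hM⟩ := hword j hj
    have hab : a = b := by
      by_contra hab
      obtain ⟨hw, hc⟩ := toWord_mul_of_ne hL hM hab
      obtain ⟨c, hc', hcC⟩ := h₂ i j
      have hmul : x⁻¹ * f i * x * (x⁻¹ * f j * x) = x⁻¹ * (f i * f j) * x := by group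
      have hle := norm_le_of_isConj (hw ▸ hc) (hmul ▸ hc'.trans (hconj _))
      have hnorm := congrArg List.length hw
      rw [List.length_append] at hnorm
      simp only [norm] at hle hi hj hcC
      omega
    subst hab
    have hlen := congrArg List.length hM
    have hMa : x⁻¹ * f j * x = mk [a] * mk M * (mk [a])⁻¹ := by
      rw [← mk_toWord (x := x⁻¹ * f j * x), hM]
      simp [inv_mk, mul_mk, invRev]
    have hcancel : (mk [a])⁻¹ * (x⁻¹ * f j * x) * ((mk [a])⁻¹)⁻¹ = mk M := by
      rw [hMa]; group
    rw [hcancel]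
    have hMle := norm_mk_le (L₁ := M)
    have hxj := hx j
    simp only [List.length_cons, List.length_append] at hlen
    simp only [norm] at hMle hxj ⊢
    omega
  · have hle := norm_conj_le (mk [a])⁻¹ (x⁻¹ * f j * x)
    have ha := norm_mk_le (L₁ := [a])
    rw [norm_inv_eq] at hle
    simp only [List.length_singleton] at ha
    omega

theorem finite_setOf_norm_le [Finite α] (D : ℕ) : {x : FreeGroup α | norm x ≤ D}.Finite :=
  (List.finite_length_le (α × Bool) D).preimage toWord_injective.injOn

/-- A finite set of conjugacy classes has representatives of bounded norm. -/
theorem exists_norm_le_of_finite_range {ι : Type*} {u : ι → FreeGroup α}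
    (h : (Set.range fun i => ConjClasses.mk (u i)).Finite) :
    ∃ C, ∀ i, ∃ c, IsConj c (u i) ∧ norm c ≤ C := by
  obtain ⟨C, hC⟩ := (h.image fun k => norm (Quotient.out k)).bddAbove
  exact ⟨C, fun i => ⟨Quotient.out (ConjClasses.mk (u i)),
    ConjClasses.mk_eq_mk_iff_isConj.1 (Quotient.out_eq _), hC ⟨_, ⟨i, rfl⟩, rfl⟩⟩⟩

end FreeGroup

/-- If `(g_n)` is a sequence of automorphisms of the free group `F_N` (`N ≥ 2`)
representing pairwise distinct outer automorphisms, then there exists `w ∈ F_N`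
whose sequence of images has infinitely many distinct conjugacy classes. -/
theorem exists_elt_with_infinitely_many_conjugacy_classes_of_images
    (N : ℕ) (hN : 2 ≤ N)
    (g : ℕ → MulAut (FreeGroup (Fin N)))
    (hdist : ∀ m n : ℕ, m ≠ n → ¬ IsInnerAut (g n * (g m)⁻¹)) :
    ∃ w : FreeGroup (Fin N),
      (Set.range fun n : ℕ => ConjClasses.mk ((g n) w)).Infinite := by
  by_contra! hfin
  choose C hC using fun w => FreeGroup.exists_norm_le_of_finite_range (hfin w)
  obtain ⟨K, hK⟩ := ((Set.finite_range fun i : Fin N => C (FreeGroup.of i)).union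
    (Set.finite_range fun p : Fin N × Fin N => C (FreeGroup.of p.1 * FreeGroup.of p.2))).bddAbove
  have hconj (n : ℕ) : ∃ x, ∀ i, FreeGroup.norm (x⁻¹ * g n (FreeGroup.of i) * x) ≤ K + 2 := by
    refine FreeGroup.exists_forall_norm_conj_le (fun i => g n (FreeGroup.of i)) K
      (fun i => ?_) fun i j => ?_
    · obtain ⟨c, hc, hle⟩ := hC (FreeGroup.of i) n
      exact ⟨c, hc, hle.trans (hK (.inl ⟨i, rfl⟩))⟩
    · obtain ⟨c, hc, hle⟩ := hC (FreeGroup.of i * FreeGroup.of j) n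
      exact ⟨c, map_mul (g n) _ _ ▸ hc, hle.trans (hK (.inr ⟨(i, j), rfl⟩))⟩
  choose x hx using hconj
  obtain ⟨m, -, n, -, hmn, heq⟩ := Set.infinite_univ.exists_ne_map_eq_of_mapsTo
    (f := fun n i => (x n)⁻¹ * g n (FreeGroup.of i) * x n)
    (t := Set.univ.pi fun _ : Fin N => {y | FreeGroup.norm y ≤ K + 2})
    (fun n _ i _ => hx n i) (Set.Finite.pi fun _ => FreeGroup.finite_setOf_norm_le _)
  have hhom : (MulAut.conj (x m)⁻¹ * g m).toMonoidHom = (MulAut.conj (x n)⁻¹ * g n).toMonoidHom := by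
    ext i
    simpa using congrFun heq i
  refine hdist m n hmn ⟨x n * (x m)⁻¹, fun y => ?_⟩
  have hy := DFunLike.congr_fun hhom ((g m)⁻¹ y)
  have hy' : (x m)⁻¹ * y * x m = (x n)⁻¹ * (g n * (g m)⁻¹) y * x n := by simpa using hy
  calc (g n * (g m)⁻¹) y = x n * ((x n)⁻¹ * (g n * (g m)⁻¹) y * x n) * (x n)⁻¹ := by group
    _ = x n * (x m)⁻¹ * y * (x n * (x m)⁻¹)⁻¹ := by rw [← hy']; group
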